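/- If the integer matrix θ − I has rank 2 (i.e. det(θ − I) ≠ 0), then H²(G, ℤ) is isomorphic to (ℤ²/(θ − I)ℤ²) ⊕ ℤ when det θ = 1, and to ℤ²/(θ − I)ℤ² when det θ = −1; in both cases the finite group ℤ²/(θ − I)ℤ² has order |det(θ − I)|. -/

import Mathlib

/-- The automorphism of `ℤ²` (written multiplicatively) induced by a matrix `θ ∈ GL(2, ℤ)`. -/
noncomputable def torusAut (θ : GL (Fin 2) ℤ) : MulAut (Multiplicative (Fin 2 → ℤ)) :=
  AddEquiv.toMultiplicative
    ((LinearMap.GeneralLinearGroup.generalLinearEquiv ℤ (Fin 2 → ℤ)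
      (Matrix.GeneralLinearGroup.toLin θ)).toAddEquiv)

/-- The action of `ℤ` on `ℤ²` in which the generator `1 ∈ ℤ` acts via `θ`. -/
noncomputable def torusAction (θ : GL (Fin 2) ℤ) :
    Multiplicative ℤ →* MulAut (Multiplicative (Fin 2 → ℤ)) :=
  zpowersHom _ (torusAut θ)

/-- The fundamental group `G = ℤ² ⋊_θ ℤ` of the torus bundle with monodromy `θ`. -/
noncomputable def TorusBundleGroup (θ : GL (Fin 2) ℤ) : Type :=
  SemidirectProduct (Multiplicative (Fin 2 → ℤ)) (Multiplicative ℤ) (torusAction θ)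

noncomputable instance (θ : GL (Fin 2) ℤ) : Group (TorusBundleGroup θ) :=
  inferInstanceAs (Group (SemidirectProduct _ _ _))
namespace TB
section
open Matrix Module
lemma cokEquiv (A B U V : Matrix (Fin 2) (Fin 2) ℤ) (hU : IsUnit U) (hV : IsUnit V)
    (h : U * A = B * V) :
    Nonempty (((Fin 2 → ℤ) ⧸ LinearMap.range A.mulVecLin) ≃ₗ[ℤ]
      ((Fin 2 → ℤ) ⧸ LinearMap.range B.mulVecLin)) := by
  obtain ⟨u, rfl⟩ := hU
  obtain ⟨v, rfl⟩ := hV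
  refine ⟨Submodule.Quotient.equiv _ _
    (LinearMap.GeneralLinearGroup.generalLinearEquiv ℤ (Fin 2 → ℤ)
      (Matrix.GeneralLinearGroup.toLin u)) ?_⟩
  ext y
  simp only [Submodule.mem_map, LinearMap.mem_range, exists_exists_eq_and]
  constructor
  · rintro ⟨x, rfl⟩
    refine ⟨(v : Matrix _ _ ℤ) *ᵥ x, ?_⟩
    change B *ᵥ _ *ᵥ _ = (u : Matrix _ _ ℤ) *ᵥ (A *ᵥ x)
    rw [mulVec_mulVec, mulVec_mulVec, h]
  · rintro ⟨x, rfl⟩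
    refine ⟨((v⁻¹ : _ˣ) : Matrix _ _ ℤ) *ᵥ x, ?_⟩
    change (u : Matrix _ _ ℤ) *ᵥ (A *ᵥ _) = B *ᵥ x
    rw [mulVec_mulVec, mulVec_mulVec, h, Matrix.mul_assoc, Units.mul_inv, Matrix.mul_one]

lemma inj_of_rank (M : Matrix (Fin 2) (Fin 2) ℤ) (h : M.rank = 2) :
    Function.Injective M.mulVecLin := by
  have h1 := Submodule.finrank_quotient_add_finrank (LinearMap.ker M.mulVecLin)
  rw [M.mulVecLin.quotKerEquivRange.finrank_eq] at h1
  rw [Matrix.rank] at h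
  rw [h, Module.finrank_fin_fun] at h1
  rw [← LinearMap.ker_eq_bot]
  exact Submodule.finrank_eq_zero.1 (by omega)

lemma card_coker (M : Matrix (Fin 2) (Fin 2) ℤ) (h : M.rank = 2) :
    Nat.card ((Fin 2 → ℤ) ⧸ LinearMap.range M.mulVecLin) = M.det.natAbs := by
  rw [← Submodule.natAbs_det_equiv _ (LinearEquiv.ofInjective _ (inj_of_rank M h))]
  congr 1
  rw [← LinearMap.det_toLin']
  rfl

lemma coker_transpose (M : Matrix (Fin 2) (Fin 2) ℤ) (h : M.rank = 2) :
    Nonempty (((Fin 2 → ℤ) ⧸ LinearMap.range Mᵀ.mulVecLin) ≃ₗ[ℤ]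
      ((Fin 2 → ℤ) ⧸ LinearMap.range M.mulVecLin)) := by
  obtain ⟨b', a, bN, hb⟩ := Submodule.exists_smith_normal_form_of_rank_eq (Pi.basisFun ℤ (Fin 2))
    (N := LinearMap.range M.mulVecLin) (by simpa [Matrix.rank] using h)
  let e := LinearEquiv.ofInjective _ (inj_of_rank M h)
  let q : Basis (Fin 2) ℤ (Fin 2 → ℤ) := bN.map e.symm
  let P := (Pi.basisFun ℤ (Fin 2)).toMatrix b'
  let Q := (Pi.basisFun ℤ (Fin 2)).toMatrix q
  have hP : IsUnit P := IsUnit.of_mul_eq_one _ ((Pi.basisFun ℤ (Fin 2)).toMatrix_mul_toMatrix_flip b')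
  have hQ : IsUnit Q := IsUnit.of_mul_eq_one _ ((Pi.basisFun ℤ (Fin 2)).toMatrix_mul_toMatrix_flip q)
  have key : M * Q = P * diagonal a := by
    ext i j
    have h1 : M *ᵥ (q j) = a j • b' j := by
      rw [← hb]
      have : e (q j) = bN j := by simp [q]
      rw [← this]; rfl
    have h2 := congrFun h1 i
    simp only [mul_diagonal]
    rw [Matrix.mul_apply]
    simp only [P, Q, Basis.toMatrix_apply, Pi.basisFun_repr]
    simp only [mulVec, dotProduct, Pi.smul_apply, smul_eq_mul] at h2
    rw [h2, mul_comm]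
  obtain ⟨p, hp⟩ := hP
  obtain ⟨qq, hq⟩ := hQ
  obtain ⟨e1⟩ := cokEquiv (diagonal a) M P Q ⟨p, hp⟩ ⟨qq, hq⟩ key.symm
  obtain ⟨e2⟩ := cokEquiv Mᵀ (diagonal a) Qᵀ Pᵀ ((isUnit_transpose _).2 ⟨qq, hq⟩) ((isUnit_transpose _).2 ⟨p, hp⟩)
    (by have := congrArg transpose key
        simpa using this)
  exact ⟨e2.trans e1⟩
end
/-- Normalised form of the 2-cocycle identity for trivial coefficients. -/
def IsC {G A : Type*} [Group G] [AddCommGroup A] (F : G → G → A) : Prop :=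
  ∀ g h j, F (g * h) j + F g h = F h j + F g (h * j)

/-- The central extension attached to a cocycle. -/
@[ext] structure Ext {G A : Type*} [Group G] [AddCommGroup A] (F : G → G → A) (hF : IsC F) where
  x : A
  g : G

namespace Ext
variable {G A : Type*} [Group G] [AddCommGroup A] {F : G → G → A} {hF : IsC F}

instance : Mul (Ext F hF) := ⟨fun a b => ⟨a.x + b.x + F a.g b.g, a.g * b.g⟩⟩
instance : One (Ext F hF) := ⟨⟨-F 1 1, 1⟩⟩
instance : Inv (Ext F hF) := ⟨fun a => ⟨-a.x - F a.g⁻¹ a.g - F 1 1, a.g⁻¹⟩⟩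

@[simp] lemma mul_x (a b : Ext F hF) : (a * b).x = a.x + b.x + F a.g b.g := rfl
@[simp] lemma mul_g (a b : Ext F hF) : (a * b).g = a.g * b.g := rfl
@[simp] lemma one_x : (1 : Ext F hF).x = -F 1 1 := rfl
@[simp] lemma one_g : (1 : Ext F hF).g = 1 := rfl
@[simp] lemma inv_x (a : Ext F hF) : (a⁻¹).x = -a.x - F a.g⁻¹ a.g - F 1 1 := rfl
@[simp] lemma inv_g (a : Ext F hF) : (a⁻¹).g = a.g⁻¹ := rfl

lemma one_left {hF : IsC F} (g : G) : F 1 g = F 1 1 := by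
  have := hF 1 1 g
  simp only [one_mul] at this
  exact (add_left_cancel this).symm

lemma one_right {hF : IsC F} (g : G) : F g 1 = F 1 1 := by
  have := hF g 1 1
  simp only [mul_one] at this
  exact add_right_cancel this

instance : Group (Ext F hF) := Group.ofLeftAxioms
  (fun a b c => by
    ext
    · have := hF a.g b.g c.g
      simp only [mul_x, mul_g]
      calc _ = a.x + b.x + c.x + (F (a.g * b.g) c.g + F a.g b.g) := by abel
        _ = _ := by rw [this]; abel
    · simp [mul_assoc])
  (fun a => by
    ext
    · simp [one_left (hF := hF)]
    · simp)
  (fun a => by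
    ext
    · simp only [mul_x, inv_x, inv_g, one_x]; abel
    · simp)

/-- projection to `G` -/
def pr : Ext F hF →* G where
  toFun := Ext.g
  map_one' := rfl
  map_mul' _ _ := rfl

lemma pr_apply (e : Ext F hF) : pr e = e.g := rfl

/-- the central inclusion -/
def ι : Multiplicative A →* Ext F hF where
  toFun x := ⟨x.toAdd - F 1 1, 1⟩
  map_one' := by ext <;> simp
  map_mul' x y := by
    ext
    · simp only [mul_x, toAdd_mul]; abel
    · simp

lemma ι_comm (x : Multiplicative A) (e : Ext F hF) : Commute (ι x) e := by
  ext
  · simp [ι, one_left (hF := hF), one_right (hF := hF), add_comm]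
  · simp [ι]

lemma ι_inj : Function.Injective (ι : Multiplicative A →* Ext F hF) := by
  intro x y h
  have := congrArg Ext.x h
  simpa [ι] using this

lemma eq_ι (e : Ext F hF) (h : e.g = 1) : e = ι (Multiplicative.ofAdd (e.x + F 1 1)) := by
  ext <;> simp [ι, h]

/-- change of coefficients -/
def push {B : Type*} [AddCommGroup B] (u : A →+ B) {F' : G → G → B} {hF' : IsC F'}
    (h : ∀ g k, u (F g k) = F' g k) : Ext F hF →* Ext F' hF' where
  toFun e := ⟨u e.x, e.g⟩
  map_one' := by ext <;> simp [h]
  map_mul' a b := by ext <;> simp [h]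

lemma push_ι {B : Type*} [AddCommGroup B] (u : A →+ B) {F' : G → G → B} {hF' : IsC F'}
    (h : ∀ g k, u (F g k) = F' g k) (x : A) :
    push (hF := hF) (hF' := hF') u h (ι (Multiplicative.ofAdd x)) = ι (Multiplicative.ofAdd (u x)) := by
  ext <;> simp [push, ι, h]
end Ext

/-- The relations of the torus bundle group, lifted to a central extension. -/
structure Rel {E A : Type*} [Group E] [AddCommGroup A] (ι : Multiplicative A →* E)
    (M : Matrix (Fin 2) (Fin 2) ℤ) (a b t : E) (k₁ k₂ c : A) : Prop where
  r1 : t * a = ι (.ofAdd k₁) * (a ^ M 0 0 * b ^ M 1 0) * t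
  r2 : t * b = ι (.ofAdd k₂) * (a ^ M 0 1 * b ^ M 1 1) * t
  r3 : a * b = ι (.ofAdd c) * (b * a)

lemma Rel.map {E A E' A' : Type*} [Group E] [AddCommGroup A] [Group E'] [AddCommGroup A']
    {ι : Multiplicative A →* E} {ι' : Multiplicative A' →* E'} {M : Matrix (Fin 2) (Fin 2) ℤ}
    {a b t : E} {k₁ k₂ c : A} (h : Rel ι M a b t k₁ k₂ c) (p : E →* E') (u : A → A')
    (hp : ∀ x, p (ι (.ofAdd x)) = ι' (.ofAdd (u x))) :
    Rel ι' M (p a) (p b) (p t) (u k₁) (u k₂) (u c) where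
  r1 := by simpa [hp] using congrArg p h.r1
  r2 := by simpa [hp] using congrArg p h.r2
  r3 := by simpa [hp] using congrArg p h.r3

lemma Rel.unique {E A : Type*} [Group E] [AddCommGroup A]
    {ι : Multiplicative A →* E} (hι : Function.Injective ι) {M : Matrix (Fin 2) (Fin 2) ℤ}
    {a b t : E} {k₁ k₂ c k₁' k₂' c' : A} (h : Rel ι M a b t k₁ k₂ c)
    (h' : Rel ι M a b t k₁' k₂' c') : k₁ = k₁' ∧ k₂ = k₂' ∧ c = c' := by
  refine ⟨?_, ?_, ?_⟩
  · have := h.r1.symm.trans h'.r1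
    exact Multiplicative.ofAdd.injective (hι (mul_right_cancel (mul_right_cancel this)))
  · have := h.r2.symm.trans h'.r2
    exact Multiplicative.ofAdd.injective (hι (mul_right_cancel (mul_right_cancel this)))
  · have := h.r3.symm.trans h'.r3
    exact Multiplicative.ofAdd.injective (hι (mul_right_cancel this))

/-- class two commutation -/
lemma comm_zpow {E : Type*} [Group E] {a b z : E} (hz : ∀ e, Commute z e)
    (h : a * b = z * (b * a)) (m n : ℤ) : a ^ m * b ^ n = z ^ (m * n) * (b ^ n * a ^ m) := by
  have h1 : ∀ m : ℤ, b⁻¹ * a ^ m * b = z ^ m * a ^ m := by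
    intro m
    have : b⁻¹ * a * b = z * a := by
      rw [mul_assoc, h, ← mul_assoc, ← (hz b⁻¹).eq]; group
    have h2 := conj_zpow (a := b⁻¹) (b := a) (i := m)
    rw [inv_inv] at h2
    rw [← h2, this, (hz a).mul_zpow]
  have h2 : a ^ m * b * (a ^ m)⁻¹ = z ^ m * b := by
    have := h1 m
    rw [mul_assoc, inv_mul_eq_iff_eq_mul] at this
    rw [this, ← mul_assoc, ← ((hz b).zpow_left m).eq]
    group
  have h3 := conj_zpow (a := a ^ m) (b := b) (i := n)
  rw [h2, ((hz b).zpow_left m).mul_zpow, ← zpow_mul, eq_mul_inv_iff_mul_eq] at h3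
  rw [← h3, mul_assoc]

lemma Rel.det {E A : Type*} [Group E] [AddCommGroup A]
    {ι : Multiplicative A →* E} (hι : Function.Injective ι) (hc : ∀ x e, Commute (ι x) e)
    {M : Matrix (Fin 2) (Fin 2) ℤ}
    {a b t : E} {k₁ k₂ c : A} (h : Rel ι M a b t k₁ k₂ c) : M.det • c = c := by
  set z := ι (.ofAdd c) with hzz
  have hz : ∀ e, Commute z e := hc _
  have hzn : ∀ n : ℤ, ∀ e, Commute (z ^ n) e := fun n e => (hz e).zpow_left n
  have key : ∀ x y x' y' : ℤ, (a ^ x * b ^ y) * (a ^ x' * b ^ y') =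
      z ^ (-(x' * y)) * (a ^ (x + x') * b ^ (y + y')) := by
    intro x y x' y'
    have h1 : b ^ y * a ^ x' = z ^ (-(x' * y)) * (a ^ x' * b ^ y) := by
      rw [comm_zpow hz h.r3]; group
    calc _ = a ^ x * (b ^ y * a ^ x') * b ^ y' := by group
      _ = (a ^ x * z ^ (-(x' * y))) * a ^ x' * b ^ y * b ^ y' := by rw [h1]; group
      _ = _ := by rw [← (hzn _ (a ^ x)).eq]; group
  have hA : t * a * t⁻¹ = ι (.ofAdd k₁) * (a ^ M 0 0 * b ^ M 1 0) := by rw [h.r1]; group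
  have hB : t * b * t⁻¹ = ι (.ofAdd k₂) * (a ^ M 0 1 * b ^ M 1 1) := by rw [h.r2]; group
  have h1 : (t * a * t⁻¹) * (t * b * t⁻¹) = z * ((t * b * t⁻¹) * (t * a * t⁻¹)) := by
    calc _ = t * (a * b) * t⁻¹ := by group
      _ = (t * z) * (b * a) * t⁻¹ := by rw [h.r3, ← hzz]; group
      _ = _ := by rw [← (hz t).eq]; group
  have e : ∀ (p q : Multiplicative A) (u v : E), ι p * u * (ι q * v) = ι (p * q) * (u * v) := by
    intro p q u v
    rw [map_mul, mul_assoc, ← mul_assoc u, ← (hc q u).eq]; group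
  rw [hA, hB, e, e, key, key, mul_comm (Multiplicative.ofAdd k₂), ← mul_assoc z,
    (hz _).eq, mul_assoc (ι _) z] at h1
  have h2 := mul_left_cancel h1
  rw [← mul_assoc z, add_comm (M 0 1), add_comm (M 1 1)] at h2
  have h3 := mul_right_cancel h2
  have h4 : z ^ (M.det) = z := by
    rw [Matrix.det_fin_two]
    have : M 0 0 * M 1 1 - M 0 1 * M 1 0 = -(M 0 1 * M 1 0) + M 0 0 * M 1 1 := by ring
    rw [this, zpow_add, h3]; group
  rw [hzz, ← map_zpow] at h4
  exact Multiplicative.ofAdd.injective (hι h4)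

open SemidirectProduct Multiplicative

/-- the group of the torus bundle as a bare semidirect product -/
abbrev S (θ : GL (Fin 2) ℤ) : Type :=
  SemidirectProduct (Multiplicative (Fin 2 → ℤ)) (Multiplicative ℤ) (torusAction θ)

/-- generator -/
noncomputable def gA (θ : GL (Fin 2) ℤ) : S θ := inl (ofAdd ![1, 0])
/-- generator -/
noncomputable def gB (θ : GL (Fin 2) ℤ) : S θ := inl (ofAdd ![0, 1])
/-- generator -/
noncomputable def gT (θ : GL (Fin 2) ℤ) : S θ := inr (ofAdd 1)

lemma torusAut_apply (θ : GL (Fin 2) ℤ) (n : Multiplicative (Fin 2 → ℤ)) :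
    torusAut θ n = ofAdd (Matrix.mulVec (θ : Matrix (Fin 2) (Fin 2) ℤ) n.toAdd) := rfl

lemma inl_eq (θ : GL (Fin 2) ℤ) (n : Fin 2 → ℤ) :
    (inl (ofAdd n) : S θ) = gA θ ^ n 0 * gB θ ^ n 1 := by
  rw [gA, gB, ← map_zpow (inl : _ →* S θ), ← map_zpow (inl : _ →* S θ), ← map_mul]
  congr 1
  rw [← ofAdd_zsmul, ← ofAdd_zsmul, ← ofAdd_add]
  congr 1
  ext i
  fin_cases i <;> simp

lemma gT_conj (θ : GL (Fin 2) ℤ) (n : Multiplicative (Fin 2 → ℤ)) :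
    gT θ * inl n = inl (torusAut θ n) * gT θ := by
  have := inl_aut (φ := torusAction θ) (ofAdd 1) n
  have h2 : torusAction θ (ofAdd 1) = torusAut θ := by simp [torusAction]
  rw [h2] at this
  rw [this, gT, map_inv]; group

lemma relS (θ : GL (Fin 2) ℤ) : Rel (1 : Multiplicative ℤ →* S θ) θ (gA θ) (gB θ) (gT θ) 0 0 0 where
  r1 := by
    rw [gA, gT_conj, torusAut_apply, inl_eq]
    simp [gA]
  r2 := by
    rw [gB, gT_conj, torusAut_apply, inl_eq]
    simp [gB]
  r3 := by
    simp only [gA, gB, MonoidHom.one_apply, one_mul, ← map_mul]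
    rw [mul_comm]

lemma S_hom_ext {θ : GL (Fin 2) ℤ} {H : Type*} [Group H] {p q : S θ →* H}
    (h1 : p (gA θ) = q (gA θ)) (h2 : p (gB θ) = q (gB θ)) (h3 : p (gT θ) = q (gT θ)) : p = q := by
  apply SemidirectProduct.hom_ext
  · refine MonoidHom.ext fun n => ?_
    obtain ⟨n, rfl⟩ := ofAdd.surjective n
    simp only [MonoidHom.comp_apply]
    rw [inl_eq]; simp [h1, h2]
  · apply MonoidHom.ext_mint
    exact h3

lemma conj_pow {N E : Type*} [Group N] [Group E] (σ : MulAut N) (p : N →* E) (t : E)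
    (h : ∀ n, p (σ n) = t * p n * t⁻¹) (i : ℤ) : ∀ n, p ((σ ^ i) n) = t ^ i * p n * (t ^ i)⁻¹ := by
  have h' : ∀ n, p (σ⁻¹ n) = t⁻¹ * p n * t := by
    intro n
    have := h (σ⁻¹ n)
    rw [MulAut.apply_inv_self] at this
    rw [this]; group
  induction i with
  | zero => intro n; simp
  | succ i ih => 
    intro n
    rw [zpow_add_one, MulAut.mul_apply, ih, h]; group
  | pred i ih =>
    intro n
    rw [zpow_sub_one, MulAut.mul_apply, ih, h']; group

lemma split_hom (θ : GL (Fin 2) ℤ) {E : Type*} [Group E] {a b t : E}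
    (h : Rel (1 : Multiplicative ℤ →* E) θ a b t 0 0 0) :
    ∃ σ : S θ →* E, σ (gA θ) = a ∧ σ (gB θ) = b ∧ σ (gT θ) = t := by
  obtain ⟨r1, r2, r3⟩ := h
  simp only [MonoidHom.one_apply, one_mul] at r1 r2 r3
  have hab : Commute a b := r3
  let f1 : Multiplicative (Fin 2 → ℤ) →* E :=
    { toFun := fun n => a ^ (n.toAdd 0) * b ^ (n.toAdd 1)
      map_one' := by simp
      map_mul' := fun m n => by
        simp only [toAdd_mul, Pi.add_apply, zpow_add]
        have := (hab.zpow_zpow (n.toAdd 0) (m.toAdd 1)).eq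
        simp only [mul_assoc]
        rw [← mul_assoc (b ^ _) (a ^ _), ← this]
        simp only [mul_assoc] }
  have hf1 : ∀ n, f1 n = a ^ (n.toAdd 0) * b ^ (n.toAdd 1) := fun _ => rfl
  have hc : ∀ n, f1 (torusAut θ n) = t * f1 n * t⁻¹ := by
    intro n
    have e1 : t * a * t⁻¹ = f1 (ofAdd ![θ 0 0, θ 1 0]) := by rw [r1]; simp [hf1]
    have e2 : t * b * t⁻¹ = f1 (ofAdd ![θ 0 1, θ 1 1]) := by rw [r2]; simp [hf1]
    have : t * f1 n * t⁻¹ = (t * a * t⁻¹) ^ (n.toAdd 0) * (t * b * t⁻¹) ^ (n.toAdd 1) := by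
      rw [conj_zpow, conj_zpow, hf1]; group
    rw [this, e1, e2, ← map_zpow f1, ← map_zpow f1, ← map_mul, torusAut_apply]
    congr 1
    rw [← ofAdd_zsmul, ← ofAdd_zsmul, ← ofAdd_add]
    congr 1
    ext i
    fin_cases i <;> simp [Matrix.mulVec, dotProduct, Fin.sum_univ_two, mul_comm]
  refine ⟨SemidirectProduct.lift f1 (zpowersHom _ t) ?_, ?_, ?_, ?_⟩
  · intro g
    refine MonoidHom.ext fun n => ?_
    simpa [torusAction, ← map_zpow] using conj_pow _ f1 t hc g.toAdd n
  · simp [gA, hf1]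
  · simp [gB, hf1]
  · simp [gT]

/-- the 2-cocycles -/
def Zc (G : Type*) [Group G] : AddSubgroup (G → G → ℤ) where
  carrier := {f | IsC f}
  zero_mem' := by intro g h j; simp
  add_mem' := by
    intro f f' hf hf' g h j
    have := hf g h j
    have := hf' g h j
    simp only [Pi.add_apply]; linarith
  neg_mem' := by
    intro f hf g h j
    have := hf g h j
    simp only [Pi.neg_apply]; linarith

lemma Zc.isC {G : Type*} [Group G] (f : Zc G) : IsC f.1 := f.2

/-- the universal cocycle -/
def univ (G : Type*) [Group G] (g h : G) : Zc G →+ ℤ where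
  toFun f := f.1 g h
  map_zero' := rfl
  map_add' _ _ := rfl

lemma univ_isC (G : Type*) [Group G] : IsC (univ G) := by
  intro g h j
  ext f
  exact f.2 g h j

/-- Every cocycle has its invariants, depending linearly on the cocycle. -/
lemma exists_K (θ : GL (Fin 2) ℤ) : ∃ k₁ k₂ c : Zc (S θ) →+ ℤ, ∀ f : Zc (S θ),
    Rel (Ext.ι (hF := (Zc.isC f))) θ ⟨0, gA θ⟩ ⟨0, gB θ⟩ ⟨0, gT θ⟩ (k₁ f) (k₂ f) (c f) := by
  have hs := relS θ
  let a : Ext (univ (S θ)) (univ_isC _) := ⟨0, gA θ⟩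
  let b : Ext (univ (S θ)) (univ_isC _) := ⟨0, gB θ⟩
  let t : Ext (univ (S θ)) (univ_isC _) := ⟨0, gT θ⟩
  have ha : Ext.pr a = gA θ := rfl
  have hb : Ext.pr b = gB θ := rfl
  have ht : Ext.pr t = gT θ := rfl
  have h1 := Ext.eq_ι (t * a * (a ^ θ 0 0 * b ^ θ 1 0 * t)⁻¹) (by
    rw [← Ext.pr_apply, map_mul, map_inv, mul_inv_eq_one]
    simpa [ha, hb, ht] using hs.r1)
  have h2 := Ext.eq_ι (t * b * (a ^ θ 0 1 * b ^ θ 1 1 * t)⁻¹) (by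
    rw [← Ext.pr_apply, map_mul, map_inv, mul_inv_eq_one]
    simpa [ha, hb, ht] using hs.r2)
  have h3 := Ext.eq_ι (a * b * (b * a)⁻¹) (by
    rw [← Ext.pr_apply, map_mul, map_inv, mul_inv_eq_one]
    simpa [ha, hb, ht] using hs.r3)
  rw [mul_inv_eq_iff_eq_mul] at h1 h2 h3
  obtain ⟨k₁, k₂, c, R⟩ : ∃ k₁ k₂ c, Rel Ext.ι θ a b t k₁ k₂ c := ⟨_, _, _, by rw [mul_assoc]; exact h1, by rw [mul_assoc]; exact h2, h3⟩
  refine ⟨k₁, k₂, c, fun f => ?_⟩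
  exact R.map (Ext.push (hF := univ_isC _) (hF' := Zc.isC f) (AddMonoidHom.eval f) (fun g k => rfl)) (AddMonoidHom.eval f)
    (fun x => Ext.push_ι _ _ _)

lemma K_of_cobound (θ : GL (Fin 2) ℤ) (f : Zc (S θ)) {k₁ k₂ c : ℤ}
    (h : Rel (Ext.ι (hF := (Zc.isC f))) θ ⟨0, gA θ⟩ ⟨0, gB θ⟩ ⟨0, gT θ⟩ k₁ k₂ c)
    (φ : S θ → ℤ) (hφ : ∀ g h, f.1 g h = φ h - φ (g * h) + φ g) :
    ∃ v : Fin 2 → ℤ, Matrix.mulVec ((θ : Matrix (Fin 2) (Fin 2) ℤ) - 1).transpose v = ![k₁, k₂] ∧ c = 0 := by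
  let r : Ext f.1 (Zc.isC f) →* Multiplicative ℤ :=
    { toFun := fun e => ofAdd (e.x + φ e.g)
      map_one' := by simp [hφ]
      map_mul' := fun a b => by
        rw [← ofAdd_add]
        congr 1
        simp only [Ext.mul_x, Ext.mul_g, hφ]; ring }
  have hr : ∀ x, r (Ext.ι x) = x := by
    intro x; simp [r, Ext.ι, hφ]
  have e1 := congrArg toAdd (congrArg r h.r1)
  have e2 := congrArg toAdd (congrArg r h.r2)
  have e3 := congrArg toAdd (congrArg r h.r3)
  simp only [map_mul, hr, map_zpow, toAdd_mul, toAdd_zpow, toAdd_ofAdd, smul_eq_mul] at e1 e2 e3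
  set A := toAdd (r ⟨0, gA θ⟩)
  set B := toAdd (r ⟨0, gB θ⟩)
  refine ⟨![-A, -B], ?_, by linarith⟩
  ext i
  fin_cases i
  · simp [Matrix.mulVec, dotProduct, Fin.sum_univ_two]; linarith
  · simp [Matrix.mulVec, dotProduct, Fin.sum_univ_two]; linarith

lemma cobound_of_K (θ : GL (Fin 2) ℤ) (f : Zc (S θ)) {k₁ k₂ : ℤ}
    (h : Rel (Ext.ι (hF := (Zc.isC f))) θ ⟨0, gA θ⟩ ⟨0, gB θ⟩ ⟨0, gT θ⟩ k₁ k₂ 0)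
    (v : Fin 2 → ℤ)
    (hv : Matrix.mulVec ((θ : Matrix (Fin 2) (Fin 2) ℤ) - 1).transpose v = ![k₁, k₂]) :
    ∃ φ : S θ → ℤ, ∀ g h, f.1 g h = φ h - φ (g * h) + φ g := by
  have v1 := congrFun hv 0
  have v2 := congrFun hv 1
  simp [Matrix.mulVec, dotProduct, Fin.sum_univ_two] at v1 v2
  obtain ⟨r1, r2, r3⟩ := h
  have hc := Ext.ι_comm (F := f.1) (hF := (Zc.isC f))
  have comb : ∀ (m n : ℤ) (a b : Ext f.1 (Zc.isC f)), (Ext.ι (ofAdd (v 0)) * a) ^ m *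
      (Ext.ι (ofAdd (v 1)) * b) ^ n = Ext.ι (ofAdd (m * v 0 + n * v 1)) * (a ^ m * b ^ n) := by
    intro m n a b
    rw [(hc _ a).mul_zpow, (hc _ b).mul_zpow, ← map_zpow (Ext.ι : Multiplicative ℤ →* Ext f.1 (Zc.isC f)), ← map_zpow (Ext.ι : Multiplicative ℤ →* Ext f.1 (Zc.isC f)), ← ofAdd_zsmul, ← ofAdd_zsmul,
      ofAdd_add, map_mul, mul_assoc, ← mul_assoc (a ^ m), ← (hc _ (a ^ m)).eq]
    simp [mul_assoc]
  obtain ⟨σ, s1, s2, s3⟩ := split_hom θ (E := Ext f.1 (Zc.isC f))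
    (a := Ext.ι (ofAdd (v 0)) * ⟨0, gA θ⟩) (b := Ext.ι (ofAdd (v 1)) * ⟨0, gB θ⟩) (t := ⟨0, gT θ⟩)
    ⟨by
      rw [comb, ← mul_assoc, ← (hc _ _).eq, mul_assoc, r1, ← mul_assoc, ← mul_assoc, ← map_mul,
        ← ofAdd_add, MonoidHom.one_apply, one_mul]
      congr 4; linarith,
    by
      rw [comb, ← mul_assoc, ← (hc _ _).eq, mul_assoc, r2, ← mul_assoc, ← mul_assoc, ← map_mul,
        ← ofAdd_add, MonoidHom.one_apply, one_mul]
      congr 4; linarith,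
    by
      rw [MonoidHom.one_apply, one_mul]
      simp only [ofAdd_zero, map_one, one_mul] at r3
      exact Commute.mul_left (hc _ _) (Commute.mul_right (hc _ _).symm r3)⟩
  have hσ : Ext.pr.comp σ = MonoidHom.id _ := by
    apply S_hom_ext
    · simp [s1, Ext.pr_apply, Ext.ι]
    · simp [s2, Ext.pr_apply, Ext.ι]
    · simp [s3, Ext.pr_apply]
  have hg : ∀ g, (σ g).g = g := fun g => DFunLike.congr_fun hσ g
  refine ⟨fun g => -(σ g).x, fun g h => ?_⟩
  have := congrArg Ext.x (map_mul σ g h)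
  simp only [Ext.mul_x, hg] at this
  linarith

lemma ext_cocycle {G X : Type*} [Group G] [Group X] (p : X →* G) (r : X → ℤ)
    (j : Multiplicative ℤ →* X) (s : G → X) (hps : ∀ g, p (s g) = g) (hrs : ∀ g, r (s g) = 0)
    (hj : ∀ z x, r (j z * x) = z.toAdd + r x) (hpj : ∀ z, p (j z) = 1)
    (inj : ∀ x y, p x = p y → r x = r y → x = y) (cent : ∀ z x, Commute (j z) x) :
    ∃ f : Zc G, ∃ P : X →* Ext f.1 (Zc.isC f), (∀ g, P (s g) = ⟨0, g⟩) ∧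
      ∀ z, P (j z) = Ext.ι z := by
  let f : G → G → ℤ := fun g h => r (s g * s h)
  have dec : ∀ x, x = j (ofAdd (r x)) * s (p x) := fun x =>
    inj _ _ (by simp [hpj, hps]) (by simp [hj, hrs])
  have rmul : ∀ x y, r (x * y) = r x + r y + f (p x) (p y) := by
    intro x y
    conv_lhs => rw [dec x, dec y]
    rw [mul_assoc, hj, ← mul_assoc, ← (cent _ (s (p x))).eq, mul_assoc, hj]
    simp only [toAdd_ofAdd, f]; ring
  have hf : IsC f := by
    intro g h k
    have e1 := rmul (s g * s h) (s k)
    have e2 := rmul (s g) (s h * s k)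
    rw [mul_assoc] at e1
    simp only [map_mul, hps, hrs] at e1 e2
    have : r (s g * s h) = f g h := rfl
    have : r (s h * s k) = f h k := rfl
    linarith
  have r1 : r 1 = - f 1 1 := by
    have := rmul 1 1
    simp only [mul_one, map_one] at this
    linarith
  refine ⟨⟨f, hf⟩, ⟨⟨fun x => ⟨r x, p x⟩, ?_⟩, ?_⟩, ?_, ?_⟩
  · ext
    · simp [r1]
    · simp
  · intro x y
    ext
    · simp [rmul]
    · simp
  · intro g
    ext
    · simp [hrs]
    · simp [hps]
  · intro z
    have h1 := hj z 1
    rw [mul_one, r1] at h1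
    ext
    · simp [Ext.ι, h1]; ring
    · simp [Ext.ι, hpj]

/-- Automorphism of an extension lifting an automorphism of the quotient. -/
def liftAut {N : Type*} [Group N] {F : N → N → ℤ} (hF : IsC F) (σ : MulAut N) (q : N → ℤ)
    (hq : ∀ n n', q (n * n') + F n n' = q n + q n' + F (σ n) (σ n')) : MulAut (Ext F hF) where
  toFun e := ⟨e.x + q e.g, σ e.g⟩
  invFun e := ⟨e.x - q (σ.symm e.g), σ.symm e.g⟩
  left_inv e := by ext <;> simp
  right_inv e := by ext <;> simp
  map_mul' a b := by
    ext
    · have := hq a.g b.g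
      simp only [Ext.mul_x, Ext.mul_g]; linarith
    · simp

lemma zpow_zero_x {N : Type*} [Group N] {F : N → N → ℤ} (hF : IsC F) (g : N)
    (h : ∀ m n : ℤ, F (g ^ m) (g ^ n) = 0) (m : ℤ) : (⟨0, g⟩ : Ext F hF) ^ m = ⟨0, g ^ m⟩ := by
  let u : Multiplicative ℤ →* Ext F hF :=
    { toFun := fun m => ⟨0, g ^ m.toAdd⟩
      map_one' := by
        ext
        · have := h 0 0
          simp at this
          simp [this]
        · simp
      map_mul' := fun a b => by
        ext
        · simp [h]
        · simp [zpow_add] }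
  have h1 : (⟨0, g⟩ : Ext F hF) = u (ofAdd 1) := by simp [u]
  rw [h1, ← map_zpow u, ← ofAdd_zsmul]
  simp [u]

/-- Surjectivity in abstract form -/
lemma exists_cocycle_of_q (θ : GL (Fin 2) ℤ) {F : Multiplicative (Fin 2 → ℤ) → Multiplicative (Fin 2 → ℤ) → ℤ}
    (hF : IsC F) (h0 : F 1 1 = 0) (q : Multiplicative (Fin 2 → ℤ) → ℤ)
    (hq : ∀ n n', q (n * n') + F n n' = q n + q n' + F (torusAut θ n) (torusAut θ n'))
    {k₁ k₂ c : ℤ}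
    (e1 : liftAut hF (torusAut θ) q hq ⟨0, ofAdd ![1, 0]⟩ =
      Ext.ι (ofAdd k₁) * (⟨0, ofAdd ![1, 0]⟩ ^ θ 0 0 * ⟨0, ofAdd ![0, 1]⟩ ^ θ 1 0))
    (e2 : liftAut hF (torusAut θ) q hq ⟨0, ofAdd ![0, 1]⟩ =
      Ext.ι (ofAdd k₂) * (⟨0, ofAdd ![1, 0]⟩ ^ θ 0 1 * ⟨0, ofAdd ![0, 1]⟩ ^ θ 1 1))
    (e3 : (⟨0, ofAdd ![1, 0]⟩ * ⟨0, ofAdd ![0, 1]⟩ : Ext F hF) =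
      Ext.ι (ofAdd c) * (⟨0, ofAdd ![0, 1]⟩ * ⟨0, ofAdd ![1, 0]⟩)) :
    ∃ f : Zc (S θ), Rel (Ext.ι (hF := Zc.isC f)) θ ⟨0, gA θ⟩ ⟨0, gB θ⟩ ⟨0, gT θ⟩ k₁ k₂ c := by
  set Θ := liftAut hF (torusAut θ) q hq with hΘ
  have hpr : ∀ e, Ext.pr (Θ e) = torusAut θ (Ext.pr e) := fun _ => rfl
  have hpr' : ∀ e, Ext.pr (Θ⁻¹ e) = (torusAut θ)⁻¹ (Ext.pr e) := fun _ => rfl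
  have hprz : ∀ (i : ℤ) e, Ext.pr ((Θ ^ i) e) = (torusAut θ ^ i) (Ext.pr e) := by
    intro i
    induction i with
    | zero => intro n; simp
    | succ i ih => intro n; rw [zpow_add_one, MulAut.mul_apply, ih, hpr, zpow_add_one, MulAut.mul_apply]
    | pred i ih => intro n; rw [zpow_sub_one, MulAut.mul_apply, ih, hpr', zpow_sub_one, MulAut.mul_apply]
  have q1 : q 1 = 0 := by
    have := hq 1 1
    simp only [map_one, mul_one] at this
    linarith
  have hfix : ∀ (z : Multiplicative ℤ) (i : ℤ), (Θ ^ i) (Ext.ι z) = Ext.ι z := by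
    intro z i
    have h1 : Θ ∈ MulAction.stabilizer (MulAut (Ext F hF)) (Ext.ι z : Ext F hF) := by
      rw [MulAction.mem_stabilizer_iff]
      change Θ (Ext.ι z) = Ext.ι z
      ext <;> simp [hΘ, liftAut, Ext.ι, q1]
    exact MulAction.mem_stabilizer_iff.1 (zpow_mem h1 i)
  let φ : Multiplicative ℤ →* MulAut (Ext F hF) := zpowersHom _ Θ
  have hφ : ∀ i e, φ i e = (Θ ^ i.toAdd) e := fun i e => rfl
  let p : SemidirectProduct _ _ φ →* S θ := SemidirectProduct.map Ext.pr (MonoidHom.id _) (by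
    intro g
    refine MonoidHom.ext fun e => ?_
    exact hprz _ _)
  let s : S θ → SemidirectProduct _ _ φ := fun g => ⟨⟨0, g.left⟩, g.right⟩
  obtain ⟨f, P, hP, hPj⟩ := ext_cocycle p (fun x => x.left.x) ((inl : _ →* SemidirectProduct _ _ φ).comp Ext.ι) s
    (fun g => rfl) (fun g => rfl)
    (fun z x => by
      simp [Ext.ι, Ext.one_left (hF := hF), h0])
    (fun z => by
      simp [p, Ext.pr_apply, Ext.ι])
    (fun x y h1 h2 => by
      refine SemidirectProduct.ext (Ext.ext h2 ?_) ?_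
      · exact congrArg SemidirectProduct.left h1
      · have h3 : (p x).right = (p y).right := by rw [h1]
        exact h3)
    (fun z x => by
      refine SemidirectProduct.ext ?_ ?_
      · simp only [MonoidHom.comp_apply, mul_left, left_inl, right_inl, map_one, MulAut.one_apply, hφ, hfix]
        exact (Ext.ι_comm z x.left).eq
      · simp)
  have sA : s (gA θ) = inl ⟨0, ofAdd ![1, 0]⟩ := rfl
  have sB : s (gB θ) = inl ⟨0, ofAdd ![0, 1]⟩ := rfl
  have sT : s (gT θ) = inr (ofAdd 1) := by
    refine SemidirectProduct.ext ?_ rfl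
    ext
    · simp [s, h0]
    · simp [s, gT]
  have conj : ∀ h, s (gT θ) * inl h = inl (Θ h) * s (gT θ) := by
    intro h
    rw [sT]
    refine SemidirectProduct.ext ?_ ?_
    · simp [hφ]
    · simp
  refine ⟨f, ?_⟩
  have R : Rel ((inl : _ →* SemidirectProduct _ _ φ).comp Ext.ι) θ (s (gA θ)) (s (gB θ)) (s (gT θ)) k₁ k₂ c := by
    refine ⟨?_, ?_, ?_⟩
    · rw [sA, sB, conj, e1]; simp
    · rw [sA, sB, conj, e2]; simp
    · rw [sA, sB, ← map_mul, e3]; simp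
  have := R.map (ι' := Ext.ι) P id (fun x => hPj _)
  rwa [hP, hP, hP] at this

/-- binomial `m(m-1)/2` on integers -/
lemma exists_binom : ∃ C : ℤ → ℤ, C 0 = 0 ∧ C 1 = 0 ∧ ∀ m n, C (m + n) = C m + C n + m * n := by
  refine ⟨fun m => m * (m - 1) / 2, by simp, by simp, fun m n => ?_⟩
  have h : ∀ m : ℤ, ∃ k, m * (m - 1) = 2 * k := fun m => by
    have := Int.even_mul_pred_self m
    obtain ⟨k, hk⟩ := this
    exact ⟨k, by rw [hk]; ring⟩
  obtain ⟨a, ha⟩ := h m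
  obtain ⟨b, hb⟩ := h n
  obtain ⟨d, hd⟩ := h (m + n)
  simp only [ha, hb, hd]
  have : 2 * d = 2 * (a + b + m * n) := by rw [← hd, mul_add, mul_add, ← ha, ← hb]; ring
  omega

lemma exists_cocycle (θ : GL (Fin 2) ℤ) (k₁ k₂ c : ℤ)
    (hc : (θ : Matrix (Fin 2) (Fin 2) ℤ).det * c = c) :
    ∃ f : Zc (S θ), Rel (Ext.ι (hF := Zc.isC f)) θ ⟨0, gA θ⟩ ⟨0, gB θ⟩ ⟨0, gT θ⟩ k₁ k₂ c := by
  obtain ⟨C, C0, C1, hC⟩ := exists_binom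
  rw [Matrix.det_fin_two] at hc
  let F : Multiplicative (Fin 2 → ℤ) → Multiplicative (Fin 2 → ℤ) → ℤ :=
    fun n n' => c * (n.toAdd 0 * n'.toAdd 1)
  have hF : IsC F := by
    intro g h j
    simp only [F, toAdd_mul, Pi.add_apply]; ring
  have pA := zpow_zero_x hF (ofAdd ![1, 0]) (by intro m n; simp [F])
  have pB := zpow_zero_x hF (ofAdd ![0, 1]) (by intro m n; simp [F])
  have F1 : F 1 1 = 0 := by simp [F]
  refine exists_cocycle_of_q θ hF F1
    (fun n => c * (θ 0 0 * θ 1 0) * C (n.toAdd 0) + c * (θ 0 1 * θ 1 1) * C (n.toAdd 1) +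
      c * (θ 1 0 * θ 0 1) * (n.toAdd 0 * n.toAdd 1) + (k₁ + c * (θ 0 0 * θ 1 0)) * n.toAdd 0
       + (k₂ + c * (θ 0 1 * θ 1 1)) * n.toAdd 1) ?_ ?_ ?_ ?_
  · intro n n'
    simp only [F, torusAut_apply, toAdd_mul, Pi.add_apply, hC, toAdd_ofAdd, Matrix.mulVec, dotProduct,
      Fin.sum_univ_two]
    linear_combination (- n.toAdd 0 * n'.toAdd 1) * hc
  · rw [pA, pB]
    ext i
    · simp [liftAut, Ext.ι, C0, C1, F]
    · fin_cases i <;> simp [liftAut, Ext.ι, torusAut_apply]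
  · rw [pA, pB]
    ext i
    · simp [liftAut, Ext.ι, C0, C1, F]
    · fin_cases i <;> simp [liftAut, Ext.ι, torusAut_apply]
  · ext i
    · simp [Ext.ι, F]
    · fin_cases i <;> simp [Ext.ι]

open groupCohomology in
lemma exists_pi (G : Type) [Group G] :
    ∃ π : Zc G →+ groupCohomology (Rep.trivial ℤ G ℤ) 2, Function.Surjective π ∧
      ∀ f, π f = 0 ↔ ∃ φ : G → ℤ, ∀ g h, f.1 g h = φ h - φ (g * h) + φ g := by
  let j : Zc G →+ cocycles₂ (Rep.trivial ℤ G ℤ) :=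
    { toFun := fun f => ⟨fun p => f.1 p.1 p.2,
        (mem_cocycles₂_iff (A := Rep.trivial ℤ G ℤ) _).2 (fun g h k => f.2 g h k)⟩
      map_zero' := rfl
      map_add' := fun _ _ => rfl }
  have hj : Function.Surjective j := by
    intro x
    refine ⟨⟨fun g h => x.1 (g, h), fun g h k => ?_⟩, rfl⟩
    exact (mem_cocycles₂_iff (A := Rep.trivial ℤ G ℤ) x.1).1 x.2 g h k
  have hs : Function.Surjective (H2π (Rep.trivial ℤ G ℤ)) :=
    (ModuleCat.epi_iff_surjective _).1 inferInstance
  refine ⟨(H2π (Rep.trivial ℤ G ℤ)).hom.toAddMonoidHom.comp j, hs.comp hj, fun f => ?_⟩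
  refine (H2π_eq_zero_iff (A := Rep.trivial ℤ G ℤ) (j f)).trans ?_
  constructor
  · rintro ⟨φ, hφ⟩
    exact ⟨φ, fun g h => (congrFun hφ (g, h)).symm⟩
  · rintro ⟨φ, hφ⟩
    exact ⟨φ, funext fun p => (hφ p.1 p.2).symm⟩

lemma equiv_of_ker {A B C : Type*} [AddCommGroup A] [AddCommGroup B] [AddCommGroup C]
    (p : A →+ B) (q : A →+ C) (hp : Function.Surjective p) (hq : Function.Surjective q)
    (h : ∀ a, p a = 0 ↔ q a = 0) : Nonempty (B ≃+ C) :=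
  ⟨((QuotientAddGroup.quotientKerEquivOfSurjective p hp).symm.trans
    (QuotientAddGroup.quotientAddEquivOfEq (show p.ker = q.ker from AddSubgroup.ext h))).trans
    (QuotientAddGroup.quotientKerEquivOfSurjective q hq)⟩

/-- a pair of homs as a vector-valued hom -/
def vec {A : Type*} [AddCommGroup A] (k₁ k₂ : A →+ ℤ) : A →+ (Fin 2 → ℤ) where
  toFun a := ![k₁ a, k₂ a]
  map_zero' := by ext i; fin_cases i <;> simp
  map_add' a b := by ext i; fin_cases i <;> simp

lemma main1 (θ : GL (Fin 2) ℤ) (hd : (θ : Matrix (Fin 2) (Fin 2) ℤ).det = 1) :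
    Nonempty (groupCohomology (Rep.trivial ℤ (S θ) ℤ) 2 ≃+
      (((Fin 2 → ℤ) ⧸ LinearMap.range
        ((θ : Matrix (Fin 2) (Fin 2) ℤ) - 1).transpose.mulVecLin) × ℤ)) := by
  obtain ⟨k₁, k₂, c, hk⟩ := exists_K θ
  obtain ⟨π, hπ, hker⟩ := exists_pi (S θ)
  refine equiv_of_ker π (((Submodule.mkQ _).toAddMonoidHom.comp (vec k₁ k₂)).prod c) hπ ?_ ?_
  · rintro ⟨x, n⟩
    obtain ⟨v, rfl⟩ := Submodule.mkQ_surjective _ x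
    obtain ⟨f, hf⟩ := exists_cocycle θ (v 0) (v 1) n (by rw [hd, one_mul])
    obtain ⟨e1, e2, e3⟩ := (hk f).unique Ext.ι_inj hf
    refine ⟨f, Prod.ext ?_ e3⟩
    change Submodule.mkQ _ ![k₁ f, k₂ f] = _
    congr 1
    ext i; fin_cases i <;> simp [e1, e2]
  · intro f
    rw [hker]
    have : (((Submodule.mkQ (LinearMap.range ((θ : Matrix (Fin 2) (Fin 2) ℤ) - 1).transpose.mulVecLin)
        ).toAddMonoidHom.comp (vec k₁ k₂)).prod c) f = 0 ↔
        ![k₁ f, k₂ f] ∈ LinearMap.range ((θ : Matrix (Fin 2) (Fin 2) ℤ) - 1).transpose.mulVecLin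
          ∧ c f = 0 :=
      Prod.ext_iff.trans (and_congr (Submodule.Quotient.mk_eq_zero _) Iff.rfl)
    rw [this]
    constructor
    · rintro ⟨φ, hφ⟩
      obtain ⟨v, hv, h0⟩ := K_of_cobound θ f (hk f) φ hφ
      exact ⟨⟨v, hv⟩, h0⟩
    · rintro ⟨⟨v, hv⟩, h0⟩
      have hkf := hk f
      rw [h0] at hkf
      exact cobound_of_K θ f hkf v hv

lemma main2 (θ : GL (Fin 2) ℤ) (hd : (θ : Matrix (Fin 2) (Fin 2) ℤ).det = -1) :
    Nonempty (groupCohomology (Rep.trivial ℤ (S θ) ℤ) 2 ≃+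
      ((Fin 2 → ℤ) ⧸ LinearMap.range
        ((θ : Matrix (Fin 2) (Fin 2) ℤ) - 1).transpose.mulVecLin)) := by
  obtain ⟨k₁, k₂, c, hk⟩ := exists_K θ
  obtain ⟨π, hπ, hker⟩ := exists_pi (S θ)
  refine equiv_of_ker π ((Submodule.mkQ _).toAddMonoidHom.comp (vec k₁ k₂)) hπ ?_ ?_
  · intro x
    obtain ⟨v, rfl⟩ := Submodule.mkQ_surjective _ x
    obtain ⟨f, hf⟩ := exists_cocycle θ (v 0) (v 1) 0 (by simp)
    obtain ⟨e1, e2, e3⟩ := (hk f).unique Ext.ι_inj hf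
    refine ⟨f, ?_⟩
    change Submodule.mkQ _ ![k₁ f, k₂ f] = _
    congr 1
    ext i; fin_cases i <;> simp [e1, e2]
  · intro f
    rw [hker]
    have : ((Submodule.mkQ (LinearMap.range ((θ : Matrix (Fin 2) (Fin 2) ℤ) - 1).transpose.mulVecLin)
        ).toAddMonoidHom.comp (vec k₁ k₂)) f = 0 ↔
        ![k₁ f, k₂ f] ∈ LinearMap.range ((θ : Matrix (Fin 2) (Fin 2) ℤ) - 1).transpose.mulVecLin :=
      Submodule.Quotient.mk_eq_zero _
    rw [this]
    constructor
    · rintro ⟨φ, hφ⟩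
      obtain ⟨v, hv, h0⟩ := K_of_cobound θ f (hk f) φ hφ
      exact ⟨v, hv⟩
    · rintro ⟨v, hv⟩
      have hkf := hk f
      have h0 : c f = 0 := by
        have := hkf.det Ext.ι_inj Ext.ι_comm
        rw [hd, smul_eq_mul] at this
        linarith
      rw [h0] at hkf
      exact cobound_of_K θ f hkf v hv

end TB
/-- If `θ - I` has rank `2`, then `H²(G, ℤ)` is `(ℤ²/(θ - I)ℤ²) ⊕ ℤ` when `det θ = 1`
and `ℤ²/(θ - I)ℤ²` when `det θ = -1`; in both cases `ℤ²/(θ - I)ℤ²` is finite of order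
`|det (θ - I)|`. -/
theorem torusBundle_H2_rank2_coker (θ : GL (Fin 2) ℤ)
    (hr : ((θ : Matrix (Fin 2) (Fin 2) ℤ) - 1).rank = 2) :
    ((θ : Matrix (Fin 2) (Fin 2) ℤ).det = 1 →
      Nonempty ((groupCohomology (Rep.trivial ℤ (TorusBundleGroup θ) ℤ) 2) ≃+ (((Fin 2 → ℤ) ⧸ LinearMap.range ((θ : Matrix (Fin 2) (Fin 2) ℤ) - 1).mulVecLin) × ℤ))) ∧
    ((θ : Matrix (Fin 2) (Fin 2) ℤ).det = -1 →
      Nonempty ((groupCohomology (Rep.trivial ℤ (TorusBundleGroup θ) ℤ) 2) ≃+ ((Fin 2 → ℤ) ⧸ LinearMap.range ((θ : Matrix (Fin 2) (Fin 2) ℤ) - 1).mulVecLin))) ∧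
    Nat.card ((Fin 2 → ℤ) ⧸ LinearMap.range ((θ : Matrix (Fin 2) (Fin 2) ℤ) - 1).mulVecLin) = ((θ : Matrix (Fin 2) (Fin 2) ℤ) - 1).det.natAbs := by
  obtain ⟨e⟩ := TB.coker_transpose ((θ : Matrix (Fin 2) (Fin 2) ℤ) - 1) hr
  refine ⟨fun hd => ?_, fun hd => ?_, TB.card_coker _ hr⟩
  · obtain ⟨e'⟩ := TB.main1 θ hd
    exact ⟨e'.trans (AddEquiv.prodCongr e.toAddEquiv (AddEquiv.refl ℤ))⟩
  · obtain ⟨e'⟩ := TB.main2 θ hd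
    exact ⟨e'.trans e.toAddEquiv⟩
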